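/- arXiv:2309.02921 — 2 statements merged into one kernel-verified Lean document; each statement's English description precedes it below -/
import Mathlib

section
/- Let ω : ℝ³ → ℝ³ be a smooth compactly supported vector field with div ω = 0, and define the vector field μ : ℝ³ → ℝ³ by μ(x) = (1/(4π)) ∫_{ℝ³} ω(y) × (x − y) / ‖x − y‖³ dy (a Lebesgue integral, which converges absolutely for every x). Then μ is differentiable and curl μ = ω, i.e., for every x, (curl μ)(x) = ω(x). -/
open MeasureTheory Real

/-- The `j`-th component of the partial derivative in the `i`-th coordinate direction of a
vector field on `ℝ³`. -/
noncomputable def pderiv3 (F : EuclideanSpace ℝ (Fin 3) → EuclideanSpace ℝ (Fin 3))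
    (i j : Fin 3) (x : EuclideanSpace ℝ (Fin 3)) : ℝ :=
  fderiv ℝ F x (EuclideanSpace.single i 1) j

/-- The divergence `∂₁F₁ + ∂₂F₂ + ∂₃F₃` of a vector field on `ℝ³`. -/
noncomputable def div3 (F : EuclideanSpace ℝ (Fin 3) → EuclideanSpace ℝ (Fin 3))
    (x : EuclideanSpace ℝ (Fin 3)) : ℝ :=
  ∑ i, pderiv3 F i i x

/-- The curl `(∂₂F₃ − ∂₃F₂, ∂₃F₁ − ∂₁F₃, ∂₁F₂ − ∂₂F₁)` of a vector field on `ℝ³`. -/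
noncomputable def curl3 (F : EuclideanSpace ℝ (Fin 3) → EuclideanSpace ℝ (Fin 3))
    (x : EuclideanSpace ℝ (Fin 3)) : EuclideanSpace ℝ (Fin 3) :=
  (WithLp.equiv 2 (Fin 3 → ℝ)).symm
    ![pderiv3 F 1 2 x - pderiv3 F 2 1 x,
      pderiv3 F 2 0 x - pderiv3 F 0 2 x,
      pderiv3 F 0 1 x - pderiv3 F 1 0 x]

/-- The cross product of two vectors of `ℝ³` (with the Euclidean norm). -/
noncomputable def cross3 (u v : EuclideanSpace ℝ (Fin 3)) : EuclideanSpace ℝ (Fin 3) :=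
  (WithLp.equiv 2 (Fin 3 → ℝ)).symm
    (crossProduct (WithLp.equiv 2 (Fin 3 → ℝ) u) (WithLp.equiv 2 (Fin 3 → ℝ) v))

open Set Module in
/-- Integration of the radial derivative against the kernel `‖z‖⁻ᵈ z`. -/
theorem integral_fderiv_apply_self_div_norm_pow {E F : Type*} [NormedAddCommGroup E]
    [NormedSpace ℝ E] [FiniteDimensional ℝ E] [Nontrivial E] [MeasurableSpace E] [BorelSpace E]
    [NormedAddCommGroup F] [NormedSpace ℝ F] [CompleteSpace F]
    (μ : Measure E) [μ.IsAddHaarMeasure] {g : E → F} (hg : ContDiff ℝ 1 g)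
    (hgs : HasCompactSupport g)
    (hint : Integrable (fun z => (‖z‖ ^ finrank ℝ E)⁻¹ • fderiv ℝ g z z) μ) :
    ∫ z, (‖z‖ ^ finrank ℝ E)⁻¹ • fderiv ℝ g z z ∂μ = -(μ.toSphere.real univ • g 0) := by
  set f : E → F := fun z => (‖z‖ ^ finrank ℝ E)⁻¹ • fderiv ℝ g z z with hf
  have hmp := μ.measurePreserving_homeomorphUnitSphereProd
  have hemb := (homeomorphUnitSphereProd E).measurableEmbedding
  let G : Metric.sphere (0 : E) 1 × Ioi (0 : ℝ) → F := fun p => f (p.2.1 • p.1.1)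
  have hG : ∀ z : ({0}ᶜ : Set E), G (homeomorphUnitSphereProd E z) = f z := fun z => by
    have hz : ‖z.1‖ ≠ 0 := norm_ne_zero_iff.2 z.2
    simp [G, smul_smul, hz]
  have hGint : Integrable G (μ.toSphere.prod (.volumeIoiPow (finrank ℝ E - 1))) := by
    rw [← hmp.integrable_comp_emb hemb]
    have h := (integrableOn_iff_comap_subtypeVal (measurableSet_singleton (0 : E)).compl).1
      hint.integrableOn
    exact h.congr (.of_forall fun z => (hG z).symm)
  have hradial (θ : Metric.sphere (0 : E) 1) :
      ∫ r, G (θ, r) ∂(.volumeIoiPow (finrank ℝ E - 1)) = -g 0 := by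
    have hθ : (θ : E) ≠ 0 := ne_zero_of_mem_unit_sphere θ
    have hline : ContDiff ℝ 1 fun r : ℝ => g (r • (θ : E)) := by fun_prop
    have hsupp : HasCompactSupport fun r : ℝ => g (r • (θ : E)) :=
      hgs.comp_isClosedEmbedding (isClosedEmbedding_smul_left hθ)
    have hFTC := hsupp.integral_Ioi_deriv_eq hline 0
    simp only [zero_smul] at hFTC
    rw [← hFTC]
    simp only [Measure.volumeIoiPow, ENNReal.ofReal]
    rw [integral_withDensity_eq_integral_smul
        (measurable_subtype_coe.pow_const _).real_toNNReal,
      integral_subtype_comap measurableSet_Ioi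
        fun a : ℝ => Real.toNNReal (a ^ (finrank ℝ E - 1)) • f (a • (θ : E))]
    refine setIntegral_congr_fun measurableSet_Ioi fun r (hr : 0 < r) => ?_
    have hd : HasDerivAt (fun r : ℝ => g (r • (θ : E))) (fderiv ℝ g (r • (θ : E)) θ) r := by
      have h := (hg.differentiable one_ne_zero (r • (θ : E))).hasFDerivAt.comp_hasDerivAt r
        ((hasDerivAt_id r).smul_const (θ : E))
      simpa [Function.comp_def] using h
    have hpow : r ^ finrank ℝ E = r ^ (finrank ℝ E - 1) * r :=
      (pow_sub_one_mul finrank_pos.ne' r).symm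
    have hr' : r ^ (finrank ℝ E - 1) ≠ 0 := by positivity
    simp only [hd.deriv, hf, NNReal.smul_def, Real.coe_toNNReal _ (pow_nonneg hr.le _), norm_smul,
      norm_eq_of_mem_sphere, mul_one, Real.norm_of_nonneg hr.le, map_smul, smul_smul, hpow]
    rw [mul_inv, mul_assoc, inv_mul_cancel₀ hr.ne', mul_one, mul_inv_cancel₀ hr', one_smul]
  calc
    ∫ z, f z ∂μ = ∫ z : ({0}ᶜ : Set E), f z ∂(μ.comap (↑)) := by
      rw [integral_subtype_comap (measurableSet_singleton _).compl f, restrict_compl_singleton]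
    _ = ∫ p, G p ∂(μ.toSphere.prod (.volumeIoiPow (finrank ℝ E - 1))) := by
      rw [← hmp.integral_comp hemb]
      simp only [hG]
    _ = -(μ.toSphere.real univ • g 0) := by
      rw [integral_prod _ hGint]
      simp only [hradial, integral_const, smul_neg]

open Set Module in
/-- The kernel `‖z‖⁻ᵈ z` is locally integrable in dimension `d`. -/
theorem locallyIntegrable_norm_pow_inv_smul_self {E : Type*} [NormedAddCommGroup E]
    [NormedSpace ℝ E] [FiniteDimensional ℝ E] [Nontrivial E] [MeasurableSpace E] [BorelSpace E]
    (μ : Measure E) [μ.IsAddHaarMeasure] :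
    LocallyIntegrable (fun z : E => (‖z‖ ^ finrank ℝ E)⁻¹ • z) μ := by
  have hmeas : Measurable fun z : E => (‖z‖ ^ finrank ℝ E)⁻¹ • z := by fun_prop
  rw [locallyIntegrable_iff]
  intro k hk
  obtain ⟨r, hr⟩ := hk.isBounded.subset_ball (0 : E)
  refine IntegrableOn.mono_set ?_ hr
  have h : IntegrableOn (fun z : E => (‖z‖ ^ finrank ℝ E)⁻¹ * ‖z‖) (Metric.ball 0 r) μ := by
    refine (integrableOn_fun_norm_addHaar μ (f := fun t => (t ^ finrank ℝ E)⁻¹ * t)).2 ?_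
    refine (integrableOn_const (s := Ioo (0 : ℝ) r) (C := (1 : ℝ))
      measure_Ioo_lt_top.ne).congr_fun ?_ measurableSet_Ioo
    intro t ht
    have ht' : t ≠ 0 := ht.1.ne'
    have hpow : t ^ finrank ℝ E = t ^ (finrank ℝ E - 1) * t :=
      (pow_sub_one_mul finrank_pos.ne' t).symm
    simp only [smul_eq_mul, hpow]
    field_simp
  refine Integrable.mono' h hmeas.aestronglyMeasurable (.of_forall fun z => ?_)
  simp [norm_smul]

/-- The cross product on `ℝ³` as a continuous bilinear map. -/
noncomputable def cross3CLM : EuclideanSpace ℝ (Fin 3) →L[ℝ]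
    EuclideanSpace ℝ (Fin 3) →L[ℝ] EuclideanSpace ℝ (Fin 3) :=
  LinearMap.toContinuousLinearMap <| LinearMap.toContinuousLinearMap.toLinearMap ∘ₗ
    LinearMap.mk₂ ℝ cross3
      (fun u v w => by simp [cross3]) (fun c u v => by simp [cross3])
      (fun u v w => by simp [cross3]) (fun c u v => by simp [cross3])

@[simp]
theorem cross3CLM_apply (u v : EuclideanSpace ℝ (Fin 3)) : cross3CLM u v = cross3 u v := rfl

/-- The curl of a vector field as a continuous linear function of its Jacobian. -/
noncomputable def curlOfJacobian :
    (EuclideanSpace ℝ (Fin 3) →L[ℝ] EuclideanSpace ℝ (Fin 3)) →L[ℝ] EuclideanSpace ℝ (Fin 3) :=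
  LinearMap.toContinuousLinearMap
    { toFun A := (WithLp.equiv 2 (Fin 3 → ℝ)).symm
        ![A (EuclideanSpace.single 1 1) 2 - A (EuclideanSpace.single 2 1) 1,
          A (EuclideanSpace.single 2 1) 0 - A (EuclideanSpace.single 0 1) 2,
          A (EuclideanSpace.single 0 1) 1 - A (EuclideanSpace.single 1 1) 0]
      map_add' A B := by
        ext i
        fin_cases i <;> simp <;> ring
      map_smul' c A := by
        ext i
        fin_cases i <;> simp <;> ring }

theorem curl3_eq_curlOfJacobian (F : EuclideanSpace ℝ (Fin 3) → EuclideanSpace ℝ (Fin 3))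
    (x : EuclideanSpace ℝ (Fin 3)) : curl3 F x = curlOfJacobian (fderiv ℝ F x) := rfl

/-- The identity `curl (F × k) = (k · ∇) F - (div F) k` for a constant vector `k`, in terms of
the Jacobian `A` of `F`. -/
theorem curlOfJacobian_cross (A : EuclideanSpace ℝ (Fin 3) →L[ℝ] EuclideanSpace ℝ (Fin 3))
    (k : EuclideanSpace ℝ (Fin 3)) :
    curlOfJacobian (cross3CLM.flip.precompR _ k A) =
      A k - (∑ i, A (EuclideanSpace.single i 1) i) • k := by
  have hk : k = ∑ i, k i • EuclideanSpace.single i (1 : ℝ) := by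
    ext j
    fin_cases j <;> simp [Fin.sum_univ_three]
  have hAk (j : Fin 3) : A k j = ∑ i, k i * A (EuclideanSpace.single i 1) j := by
    conv_lhs => rw [hk]
    simp [Fin.sum_univ_three]
  ext j
  simp only [PiLp.sub_apply, PiLp.smul_apply, hAk, Fin.sum_univ_three, smul_eq_mul]
  fin_cases j <;> simp [curlOfJacobian, cross3, crossProduct] <;> ring

theorem toSphere_real_univ_euclideanSpace_three :
    (volume : Measure (EuclideanSpace ℝ (Fin 3))).toSphere.real Set.univ = 4 * π := by
  rw [Measure.toSphere_real_apply_univ, measureReal_def, EuclideanSpace.volume_ball_fin_three]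
  simp [ENNReal.toReal_ofReal (by positivity : 0 ≤ π * 4 / 3)]
  ring

/-- Biot–Savart law, "Ampère's law" part: if `ω` is a smooth compactly supported
divergence-free vector field on `ℝ³` and
`μ x = (1/(4π)) ∫ ω(y) × (x − y) / ‖x − y‖³ dy`, then the integral converges absolutely
for every `x`, and `μ` is differentiable with `curl μ = ω`. -/
theorem biot_savart_curl (ω : EuclideanSpace ℝ (Fin 3) → EuclideanSpace ℝ (Fin 3))
    (hω : ContDiff ℝ (⊤ : ℕ∞) ω) (hsupp : HasCompactSupport ω)
    (hdiv : ∀ x, div3 ω x = 0)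
    (μ : EuclideanSpace ℝ (Fin 3) → EuclideanSpace ℝ (Fin 3))
    (hμ : ∀ x, μ x = (1 / (4 * π)) •
      ∫ y, (‖x - y‖ ^ 3)⁻¹ • cross3 (ω y) (x - y)) :
    (∀ x, Integrable fun y => (‖x - y‖ ^ 3)⁻¹ • cross3 (ω y) (x - y)) ∧
      Differentiable ℝ μ ∧ ∀ x, curl3 μ x = ω x := by
  have hω1 : ContDiff ℝ 1 ω := hω.of_le (mod_cast le_top)
  set K : EuclideanSpace ℝ (Fin 3) → EuclideanSpace ℝ (Fin 3) := fun z => (‖z‖ ^ 3)⁻¹ • z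
  have hK : LocallyIntegrable K volume := by
    simpa using locallyIntegrable_norm_pow_inv_smul_self
      (volume : Measure (EuclideanSpace ℝ (Fin 3)))
  have hkernel (x y : EuclideanSpace ℝ (Fin 3)) :
      (‖x - y‖ ^ 3)⁻¹ • cross3 (ω y) (x - y) =
        cross3CLM.flip (K (x - y)) (ω (x - (x - y))) := by
    rw [sub_sub_cancel, ContinuousLinearMap.flip_apply, map_smul, cross3CLM_apply]
  have hconv : μ = (1 / (4 * π)) • convolution K ω cross3CLM.flip volume := by
    ext1 x
    rw [hμ, Pi.smul_apply, convolution_def]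
    simp only [hkernel]
    congr 1
    exact integral_sub_left_eq_self (fun t => cross3CLM.flip (K t) (ω (x - t))) volume x
  have hderiv (x : EuclideanSpace ℝ (Fin 3)) : HasFDerivAt μ ((1 / (4 * π)) •
      convolution K (fderiv ℝ ω) (cross3CLM.flip.precompR _) volume x) x := by
    rw [hconv]
    exact (hsupp.hasFDerivAt_convolution_right cross3CLM.flip hK hω1 x).const_smul _
  refine ⟨fun x => ?_, fun x => (hderiv x).differentiableAt, fun x => ?_⟩
  · simp only [hkernel]
    exact (hsupp.convolutionExists_right cross3CLM.flip hK hω.continuous x).comp_sub_left x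
  · have hcont : Continuous (fderiv ℝ ω) := hω1.continuous_fderiv one_ne_zero
    have hJ : ConvolutionExistsAt K (fderiv ℝ ω) x
        (cross3CLM.flip.precompR (EuclideanSpace ℝ (Fin 3))) volume :=
      HasCompactSupport.convolutionExists_right _ (hsupp.fderiv ℝ) hK hcont x
    rw [ConvolutionExistsAt] at hJ
    have hpoint (t : EuclideanSpace ℝ (Fin 3)) :
        curlOfJacobian (cross3CLM.flip.precompR _ (K t) (fderiv ℝ ω (x - t))) =
          -((‖t‖ ^ 3)⁻¹ • fderiv ℝ (fun z => ω (x - z)) t t) := by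
      have hfd : fderiv ℝ (fun z => ω (x - z)) t = -fderiv ℝ ω (x - t) := by
        have h := (hω1.differentiable one_ne_zero (x - t)).hasFDerivAt.comp t
          ((hasFDerivAt_id t).const_sub x)
        simpa [Function.comp_def] using h.fderiv
      have hd : ∑ i, fderiv ℝ ω (x - t) (EuclideanSpace.single i 1) i = 0 := hdiv (x - t)
      rw [curlOfJacobian_cross, hd, zero_smul, sub_zero, hfd, map_smul]
      simp
    have hg : ContDiff ℝ 1 fun z => ω (x - z) := by fun_prop
    have hgs : HasCompactSupport fun z => ω (x - z) :=
      hsupp.comp_homeomorph (Homeomorph.subLeft x)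
    have hint : Integrable fun t => (‖t‖ ^ 3)⁻¹ • fderiv ℝ (fun z => ω (x - z)) t t := by
      have h := (curlOfJacobian.integrable_comp hJ).neg
      refine h.congr (.of_forall fun t => ?_)
      rw [Pi.neg_apply, hpoint, neg_neg]
    have hradial := integral_fderiv_apply_self_div_norm_pow volume hg hgs
      (by simpa using hint)
    rw [toSphere_real_univ_euclideanSpace_three] at hradial
    simp only [finrank_euclideanSpace_fin, sub_zero] at hradial
    rw [curl3_eq_curlOfJacobian, (hderiv x).fderiv, map_smul, convolution_def,
      ← curlOfJacobian.integral_comp_comm hJ]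
    simp only [hpoint]
    rw [integral_neg, hradial, neg_neg, smul_smul, one_div, inv_mul_cancel₀ (by positivity),
      one_smul]
end

section
/- Let ω : ℝ³ → ℝ³ be a smooth compactly supported vector field with div ω = 0, and define the vector field μ : ℝ³ → ℝ³ by μ(x) = (1/(4π)) ∫_{ℝ³} ω(y) × (x − y) / ‖x − y‖³ dy (a Lebesgue integral, which converges absolutely for every x). Then μ is differentiable and div μ = 0, i.e., for every x, (div μ)(x) = 0. -/
open MeasureTheory Real

section CoulombKernel

open Filter Topology Module

variable {E : Type*} [NormedAddCommGroup E] [InnerProductSpace ℝ E]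

lemma hasFDerivAt_inv_sqrt_norm_sq_add {ε : ℝ} (hε : 0 < ε) (t : E) :
    HasFDerivAt (fun t : E => (√(‖t‖ ^ 2 + ε))⁻¹)
      (-(√(‖t‖ ^ 2 + ε) ^ 3)⁻¹ • innerSL ℝ t) t := by
  have hpos : 0 < ‖t‖ ^ 2 + ε := by positivity
  have hs : 0 < √(‖t‖ ^ 2 + ε) := Real.sqrt_pos.2 hpos
  have h1 : HasFDerivAt (fun t : E => ‖t‖ ^ 2 + ε) (2 • innerSL ℝ t) t :=
    (hasStrictFDerivAt_norm_sq t).hasFDerivAt.add_const ε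
  refine ((hasDerivAt_inv hs.ne').comp_hasFDerivAt t (h1.sqrt hpos.ne')).congr_fderiv ?_
  ext v
  simp
  field_simp

variable [FiniteDimensional ℝ E] [MeasurableSpace E] [BorelSpace E]

/-- The Coulomb kernel `t / ‖t‖³` is locally integrable in dimension at least three. -/
lemma locallyIntegrable_inv_norm_pow_three_smul {ν : Measure E} [ν.IsAddHaarMeasure]
    (hE : 3 ≤ finrank ℝ E) :
    LocallyIntegrable (fun t : E => (‖t‖ ^ 3)⁻¹ • t) ν := by
  refine locallyIntegrable_of_norm_le_rpow (C := 1) (α := 2) (by lia)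
    (by exact_mod_cast (by lia : 2 < finrank ℝ E)) (.of_forall fun t => ?_)
    (by fun_prop)
  rcases eq_or_ne t 0 with rfl | ht
  · simp
  · have h : 0 < ‖t‖ := norm_pos_iff.2 ht
    rw [Real.rpow_neg h.le, norm_smul, norm_inv, norm_pow, norm_norm]
    apply le_of_eq
    norm_cast
    field_simp

/-- Integration by parts against the regularised Coulomb kernel. -/
lemma integral_regularized_inner_mul_fderiv_comm {ν : Measure E} [ν.IsAddHaarMeasure]
    {f : E → ℝ} (hf : ContDiff ℝ 2 f) (hc : HasCompactSupport f) {ε : ℝ} (hε : 0 < ε) (v w : E) :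
    ∫ t, (√(‖t‖ ^ 2 + ε) ^ 3)⁻¹ * inner ℝ t v * fderiv ℝ f t w ∂ν =
      ∫ t, (√(‖t‖ ^ 2 + ε) ^ 3)⁻¹ * inner ℝ t w * fderiv ℝ f t v ∂ν := by
  have hs : ∀ t : E, √(‖t‖ ^ 2 + ε) ≠ 0 := fun t => (Real.sqrt_pos.2 (by positivity)).ne'
  have hN : Continuous fun t : E => (√(‖t‖ ^ 2 + ε))⁻¹ := Continuous.inv₀ (by fun_prop) hs
  have hK : Continuous fun t : E => (√(‖t‖ ^ 2 + ε) ^ 3)⁻¹ :=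
    Continuous.inv₀ (by fun_prop) fun t => pow_ne_zero 3 (hs t)
  have hd : ContDiff ℝ 1 (fderiv ℝ f) := hf.fderiv_right (by norm_num)
  have hda (w : E) : ContDiff ℝ 1 fun t => fderiv ℝ f t w := hd.clm_apply contDiff_const
  have hdc (w : E) : HasCompactSupport fun t => fderiv ℝ f t w := hc.fderiv_apply ℝ w
  have key (v w : E) : ∫ t, (√(‖t‖ ^ 2 + ε) ^ 3)⁻¹ * inner ℝ t v * fderiv ℝ f t w ∂ν =
      ∫ t, (√(‖t‖ ^ 2 + ε))⁻¹ * fderiv ℝ (fderiv ℝ f) t v w ∂ν := by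
    have h2 (t : E) : fderiv ℝ (fun t => fderiv ℝ f t w) t v = fderiv ℝ (fderiv ℝ f) t v w := by
      rw [fderiv_clm_apply (hd.differentiable (by norm_num) t) (differentiableAt_const w)]
      simp
    have h1 (t : E) : fderiv ℝ (fun t : E => (√(‖t‖ ^ 2 + ε))⁻¹) t v =
        -((√(‖t‖ ^ 2 + ε) ^ 3)⁻¹ * inner ℝ t v) := by
      rw [(hasFDerivAt_inv_sqrt_norm_sq_add hε t).fderiv]; simp
    have := integral_mul_fderiv_eq_neg_fderiv_mul_of_integrable (μ := ν) (v := v)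
      (f := fun t : E => (√(‖t‖ ^ 2 + ε))⁻¹) (g := fun t => fderiv ℝ f t w)
      (by
        simp_rw [h1]
        exact (((hK.mul (by fun_prop)).neg.mul (hda w).continuous).integrable_of_hasCompactSupport
          (hdc w).mul_left))
      ((hN.mul (((hda w).continuous_fderiv (by norm_num)).clm_apply
        continuous_const)).integrable_of_hasCompactSupport ((hdc w).fderiv_apply ℝ v).mul_left)
      ((hN.mul (hda w).continuous).integrable_of_hasCompactSupport (hdc w).mul_left)
      (fun t _ => (hasFDerivAt_inv_sqrt_norm_sq_add hε t).differentiableAt)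
      (fun t _ => (hda w).differentiable (by norm_num) t)
    simp_rw [h1, h2, neg_mul, integral_neg, neg_neg] at this
    exact this.symm
  rw [key, key]
  congr! 3 with t
  exact (hf.contDiffAt.isSymmSndFDerivAt (by simp)) v w

lemma integrable_inner_coulomb_mul_fderiv {ν : Measure E} [ν.IsAddHaarMeasure]
    (hE : 3 ≤ finrank ℝ E) {f : E → ℝ} (hf : ContDiff ℝ 1 f) (hc : HasCompactSupport f) (v w : E) :
    Integrable (fun t => (‖t‖ ^ 3)⁻¹ * inner ℝ t v * fderiv ℝ f t w) ν := by
  have h := (locallyIntegrable_inv_norm_pow_three_smul (ν := ν)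
    hE).integrable_smul_left_of_hasCompactSupport
    ((hf.continuous_fderiv one_ne_zero).clm_apply continuous_const) (hc.fderiv_apply ℝ w)
  refine (h.inner_const (𝕜 := ℝ) v).congr (.of_forall fun t => ?_)
  simp only [real_inner_smul_left]
  ring

/-- The Coulomb kernel `t / ‖t‖³` is curl-free in the sense of distributions. -/
lemma integral_inner_coulomb_mul_fderiv_comm {ν : Measure E} [ν.IsAddHaarMeasure]
    (hE : 3 ≤ finrank ℝ E) {f : E → ℝ} (hf : ContDiff ℝ 2 f) (hc : HasCompactSupport f) (v w : E) :
    ∫ t, (‖t‖ ^ 3)⁻¹ * inner ℝ t v * fderiv ℝ f t w ∂ν =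
      ∫ t, (‖t‖ ^ 3)⁻¹ * inner ℝ t w * fderiv ℝ f t v ∂ν := by
  have hlim (v w : E) : Tendsto
      (fun ε : ℝ => ∫ t, (√(‖t‖ ^ 2 + ε) ^ 3)⁻¹ * inner ℝ t v * fderiv ℝ f t w ∂ν) (𝓝[>] 0)
      (𝓝 (∫ t, (‖t‖ ^ 3)⁻¹ * inner ℝ t v * fderiv ℝ f t w ∂ν)) := by
    have hd : Continuous fun t => fderiv ℝ f t w :=
      (hf.continuous_fderiv two_ne_zero).clm_apply continuous_const
    refine tendsto_integral_filter_of_dominated_convergence _ (.of_forall fun ε => ?_) ?_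
      (integrable_inner_coulomb_mul_fderiv hE (hf.of_le one_le_two) hc v w).norm
      (.of_forall fun t => ?_)
    · have := hd.measurable
      exact Measurable.aestronglyMeasurable (by fun_prop)
    · filter_upwards [self_mem_nhdsWithin] with ε (hε : 0 < ε)
      refine .of_forall fun t => ?_
      rcases eq_or_ne t 0 with rfl | ht
      · simp
      · have h : 0 < ‖t‖ := norm_pos_iff.2 ht
        have hle : ‖t‖ ≤ √(‖t‖ ^ 2 + ε) := Real.le_sqrt_of_sq_le (by linarith)
        simp only [norm_mul, norm_inv, norm_pow, norm_norm, Real.norm_of_nonneg (Real.sqrt_nonneg _)]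
        gcongr
    · rcases eq_or_ne t 0 with rfl | ht
      · simp
      · have h : 0 < ‖t‖ := norm_pos_iff.2 ht
        have hs : √(‖t‖ ^ 2 + 0) = ‖t‖ := by simp
        have : ContinuousAt
            (fun ε : ℝ => (√(‖t‖ ^ 2 + ε) ^ 3)⁻¹ * inner ℝ t v * fderiv ℝ f t w) 0 := by
          have h3 : √(‖t‖ ^ 2 + 0) ^ 3 ≠ 0 := by rw [hs]; positivity
          have hinv := ContinuousAt.inv₀ (f := fun ε : ℝ => √(‖t‖ ^ 2 + ε) ^ 3) (by fun_prop) h3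
          exact (hinv.mul continuousAt_const).mul continuousAt_const
        simpa [ContinuousAt, hs] using this.tendsto.mono_left nhdsWithin_le_nhds
  refine tendsto_nhds_unique (hlim v w) ((hlim w v).congr' ?_)
  filter_upwards [self_mem_nhdsWithin] with ε (hε : 0 < ε)
  exact integral_regularized_inner_mul_fderiv_comm hf hc hε w v

end CoulombKernel

/-- The map `(u, v) ↦ v × u` as a continuous bilinear map. -/
noncomputable def cross3FlipCLM : EuclideanSpace ℝ (Fin 3) →L[ℝ] EuclideanSpace ℝ (Fin 3) →L[ℝ]
    EuclideanSpace ℝ (Fin 3) :=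
  LinearMap.toContinuousBilinearMap <| LinearMap.mk₂ ℝ (fun u v => cross3 v u)
    (fun _ _ _ => by simp [cross3]) (fun _ _ _ => by simp [cross3])
    (fun _ _ _ => by simp [cross3]) (fun _ _ _ => by simp [cross3])

@[simp]
lemma cross3FlipCLM_apply (u v : EuclideanSpace ℝ (Fin 3)) : cross3FlipCLM u v = cross3 v u := rfl

lemma cross3_smul_right (c : ℝ) (u v : EuclideanSpace ℝ (Fin 3)) :
    cross3 u (c • v) = c • cross3 u v := by
  simp [cross3]

lemma cross3_zero (u v : EuclideanSpace ℝ (Fin 3)) : cross3 u v 0 = u 1 * v 2 - u 2 * v 1 := by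
  simp [cross3, cross_apply]

lemma cross3_one (u v : EuclideanSpace ℝ (Fin 3)) : cross3 u v 1 = u 2 * v 0 - u 0 * v 2 := by
  simp [cross3, cross_apply]

lemma cross3_two (u v : EuclideanSpace ℝ (Fin 3)) : cross3 u v 2 = u 0 * v 1 - u 1 * v 0 := by
  simp [cross3, cross_apply]

open Convolution in
/-- Biot–Savart law, "no monopoles" part: if `ω` is a smooth compactly supported
divergence-free vector field on `ℝ³` and
`μ x = (1/(4π)) ∫ ω(y) × (x − y) / ‖x − y‖³ dy`, then the integral converges absolutely
for every `x`, and `μ` is differentiable with `div μ = 0`. -/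
theorem biot_savart_div (ω : EuclideanSpace ℝ (Fin 3) → EuclideanSpace ℝ (Fin 3))
    (hω : ContDiff ℝ (⊤ : ℕ∞) ω) (hsupp : HasCompactSupport ω)
    (hdiv : ∀ x, div3 ω x = 0)
    (μ : EuclideanSpace ℝ (Fin 3) → EuclideanSpace ℝ (Fin 3))
    (hμ : ∀ x, μ x = (1 / (4 * π)) •
      ∫ y, (‖x - y‖ ^ 3)⁻¹ • cross3 (ω y) (x - y)) :
    (∀ x, Integrable fun y => (‖x - y‖ ^ 3)⁻¹ • cross3 (ω y) (x - y)) ∧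
      Differentiable ℝ μ ∧ ∀ x, div3 μ x = 0 := by
  set K : EuclideanSpace ℝ (Fin 3) → EuclideanSpace ℝ (Fin 3) := fun t => (‖t‖ ^ 3)⁻¹ • t with hK
  have hE : 3 ≤ Module.finrank ℝ (EuclideanSpace ℝ (Fin 3)) := by simp
  have hKint : LocallyIntegrable K := locallyIntegrable_inv_norm_pow_three_smul hE
  have hint (x : EuclideanSpace ℝ (Fin 3)) :
      Integrable fun y => (‖x - y‖ ^ 3)⁻¹ • cross3 (ω y) (x - y) := by
    have h := (hsupp.convolutionExists_right cross3FlipCLM hKint hω.continuous x).integrable_swap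
    simpa only [hK, cross3FlipCLM_apply, cross3_smul_right] using h
  have hμ' : μ = (1 / (4 * π)) • (K ⋆[cross3FlipCLM] ω) := by
    funext x
    rw [hμ, Pi.smul_apply, convolution_eq_swap]
    simp only [hK, cross3FlipCLM_apply, cross3_smul_right]
  have hD (x : EuclideanSpace ℝ (Fin 3)) : HasFDerivAt μ
      ((1 / (4 * π)) • (K ⋆[cross3FlipCLM.precompR _] fderiv ℝ ω) x) x := by
    rw [hμ']
    exact (hsupp.hasFDerivAt_convolution_right cross3FlipCLM hKint
      (hω.of_le (by exact_mod_cast le_top)) x).const_smul _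
  refine ⟨hint, fun x => (hD x).differentiableAt, fun x => ?_⟩
  have hψ (j : Fin 3) : ContDiff ℝ 2 fun t => ω (x - t) j := by
    have : ContDiff ℝ 2 ω := contDiff_infty.1 hω 2
    fun_prop
  have hψc (j : Fin 3) : HasCompactSupport fun t => ω (x - t) j :=
    (hsupp.comp_homeomorph (Homeomorph.subLeft x)).comp_left
      (g := fun v : EuclideanSpace ℝ (Fin 3) => v j) (by simp)
  have hψ' (j : Fin 3) (t v : EuclideanSpace ℝ (Fin 3)) :
      fderiv ℝ (fun t => ω (x - t) j) t v = -(fderiv ℝ ω (x - t) v j) := by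
    have h1 := (hω.differentiable (by simp) (x - t)).hasFDerivAt.comp t
      ((hasFDerivAt_id t).const_sub x)
    have h2 := ((EuclideanSpace.proj j : EuclideanSpace ℝ (Fin 3) →L[ℝ] ℝ).hasFDerivAt).comp t h1
    have h3 : fderiv ℝ (fun t => ω (x - t) j) t = _ := h2.fderiv
    rw [h3]
    simp
  set A : Fin 3 → Fin 3 → EuclideanSpace ℝ (Fin 3) → ℝ :=
    fun i j t => fderiv ℝ ω (x - t) (EuclideanSpace.single i 1) j with hA
  have hAint (k i j : Fin 3) : Integrable fun t => A i j t * K t k := by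
    refine (integrable_inner_coulomb_mul_fderiv (ν := volume) hE ((hψ j).of_le one_le_two) (hψc j)
      (EuclideanSpace.single k 1) (EuclideanSpace.single i 1)).neg.congr (.of_forall fun t => ?_)
    simp [hψ', hA, hK, EuclideanSpace.inner_single_right]
    ring
  have hAcomm (k i j : Fin 3) : ∫ t, A i j t * K t k = ∫ t, A k j t * K t i := by
    have h := integral_inner_coulomb_mul_fderiv_comm (ν := volume) hE (hψ j) (hψc j)
      (EuclideanSpace.single k 1) (EuclideanSpace.single i 1)
    simp only [hψ', mul_neg, integral_neg, neg_inj, EuclideanSpace.inner_single_right] at h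
    convert h using 3 with t t <;> simp [hA, hK] <;> ring
  have hconv (i j : Fin 3) :
      (K ⋆[cross3FlipCLM.precompR _] fderiv ℝ ω) x (EuclideanSpace.single i 1) j =
        ∫ t, cross3 (fderiv ℝ ω (x - t) (EuclideanSpace.single i 1)) (K t) j := by
    have hc := hω.continuous_fderiv (by simp)
    rw [convolution_precompR_apply cross3FlipCLM hKint (hsupp.fderiv ℝ) hc]
    have h := (hsupp.fderiv_apply ℝ (EuclideanSpace.single i 1)).convolutionExists_right
      cross3FlipCLM hKint (hc.clm_apply continuous_const) x
    exact ((EuclideanSpace.proj j : EuclideanSpace ℝ (Fin 3) →L[ℝ] ℝ).integral_comp_comm h).symm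
  simp only [div3, pderiv3, (hD x).fderiv, Fin.sum_univ_three, smul_apply,
    PiLp.smul_apply, hconv, cross3_zero, cross3_one, cross3_two]
  have hsub (i j k i' j' k' : Fin 3) :
      ∫ t, (A i j t * K t k - A i' j' t * K t k') =
        (∫ t, A i j t * K t k) - ∫ t, A i' j' t * K t k' :=
    integral_sub (hAint k i j) (hAint k' i' j')
  simp only [hA] at hsub hAcomm
  rw [hsub, hsub, hsub, hAcomm 2 0 1, hAcomm 1 0 2, hAcomm 2 1 0]
  simp only [smul_eq_mul]
  ring
end
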